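/- Let 𝐗 be a delayed γ-rough path with delay r > 0 and γ ∈ (1/3, 1/2], let I = [a,b] be a compact interval, and let α, β, θ > 0 satisfy θ + γ > 1 and β + 2γ > 1. Then for every delayed (α, β, θ)-controlled path (m, ζ⁰, ζ¹) based on X on I with values in L(ℝ^d, W), the compensated Riemann sums Σ_{[t_j,t_{j+1}]∈Π} [m_{t_j} X_{t_j,t_{j+1}} + ζ⁰_{t_j} 𝕏_{t_j,t_{j+1}} + ζ¹_{t_j} 𝕏_{t_j,t_{j+1}}(−r)] converge as the mesh of the partition Π of [s,t] tends to zero, for all a ≤ s ≤ t ≤ b. Moreover, the path z_t := ∫_a^t m dX, equipped with ζ⁰ = m and ζ¹ = 0, is a delayed (γ, α, 2γ)-controlled path based on X on I, and the linear map m ↦ z from 𝒟_X^{α,β,θ}(I, L(ℝ^d, W)) to 𝒟_X^{γ,α,2γ}(I, W) is continuous. -/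

import Mathlib

noncomputable section

namespace SDDE

open Set

variable {E E₁ E₂ : Type*}

/-- `f` is `γ`-Hölder continuous on `I`. -/
def HolderOn [NormedAddCommGroup E] (γ : ℝ) (I : Set ℝ) (f : ℝ → E) : Prop :=
  ∃ C : ℝ, ∀ s ∈ I, ∀ t ∈ I, ‖f t - f s‖ ≤ C * |t - s| ^ γ

/-- The `γ`-Hölder seminorm of `f` on `I`. -/
def holderNorm [NormedAddCommGroup E] (γ : ℝ) (I : Set ℝ) (f : ℝ → E) : ℝ :=
  sInf {C : ℝ | 0 ≤ C ∧ ∀ s ∈ I, ∀ t ∈ I, ‖f t - f s‖ ≤ C * |t - s| ^ γ}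

/-- A two-parameter function has finite `γ`-Hölder seminorm on `I`. -/
def Holder2On [NormedAddCommGroup E] (γ : ℝ) (I : Set ℝ) (F : ℝ → ℝ → E) : Prop :=
  ∃ C : ℝ, ∀ s ∈ I, ∀ t ∈ I, ‖F s t‖ ≤ C * |t - s| ^ γ

/-- The `γ`-Hölder seminorm of a two-parameter function on `I`. -/
def holder2Norm [NormedAddCommGroup E] (γ : ℝ) (I : Set ℝ) (F : ℝ → ℝ → E) : ℝ :=
  sInf {C : ℝ | 0 ≤ C ∧ ∀ s ∈ I, ∀ t ∈ I, ‖F s t‖ ≤ C * |t - s| ^ γ}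

/-- A delayed `γ`-rough path with delay `r`: a path `X : ℝ → ℝ^d` together with a
Lévy area `XX` and a delayed Lévy area `XXd`, satisfying Chen's identities and
Hölder bounds.  The tensor `a ⊗ b ∈ ℝ^d ⊗ ℝ^d` is represented by the matrix
`fun i j => a i * b j`. -/
structure DelayedRoughPath (d : ℕ) (r γ : ℝ) : Type where
  X : ℝ → Fin d → ℝ
  XX : ℝ → ℝ → Fin d → Fin d → ℝ
  XXd : ℝ → ℝ → Fin d → Fin d → ℝ
  holX : ∀ a b : ℝ, HolderOn γ (Icc a b) X
  contXX : Continuous fun p : ℝ × ℝ => XX p.1 p.2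
  contXXd : Continuous fun p : ℝ × ℝ => XXd p.1 p.2
  chen : ∀ s u t : ℝ, XX s t = XX s u + XX u t + fun i j => (X u i - X s i) * (X t j - X u j)
  chend : ∀ s u t : ℝ,
    XXd s t = XXd s u + XXd u t + fun i j => (X (u - r) i - X (s - r) i) * (X t j - X u j)
  holXX : ∀ a b : ℝ, Holder2On (2 * γ) (Icc a b) XX
  holXXd : ∀ a b : ℝ, Holder2On (2 * γ) (Icc a b) XXd

variable {d : ℕ} {r γ : ℝ}

/-- The rough path "norm" `‖RP‖_{γ;[a,b]}`. -/
def DelayedRoughPath.hnorm (RP : DelayedRoughPath d r γ) (a b : ℝ) : ℝ :=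
  holderNorm γ (Icc a b) RP.X + holderNorm γ (Icc (a - r) (b - r)) RP.X +
    Real.sqrt (holder2Norm (2 * γ) (Icc a b) RP.XX) +
    Real.sqrt (holder2Norm (2 * γ) (Icc a b) RP.XXd)

section Controlled

variable [NormedAddCommGroup E] [NormedSpace ℝ E]

/-- `(m, m')` is a `β`-controlled path based on `X` on `I`: `m'` is `β`-Hölder and the
remainder `m_{s,t} - m'_s X_{s,t}` has finite `2β`-Hölder seminorm. -/
def IsControlled (β : ℝ) (X : ℝ → Fin d → ℝ) (I : Set ℝ)
    (m : ℝ → E) (m' : ℝ → (Fin d → ℝ) →L[ℝ] E) : Prop :=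
  HolderOn β I m' ∧
    ∃ C : ℝ, ∀ s ∈ I, ∀ t ∈ I, ‖m t - m s - m' s (X t - X s)‖ ≤ C * |t - s| ^ (2 * β)

/-- The norm of the controlled path `(m, m')` in `𝒟_X^β([a,b])`. -/
def cpNorm (β : ℝ) (X : ℝ → Fin d → ℝ) (a b : ℝ)
    (m : ℝ → E) (m' : ℝ → (Fin d → ℝ) →L[ℝ] E) : ℝ :=
  ‖m a‖ + ‖m' a‖ + holderNorm β (Icc a b) m' +
    sInf {C : ℝ | 0 ≤ C ∧ ∀ s ∈ Icc a b, ∀ t ∈ Icc a b,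
      ‖m t - m s - m' s (X t - X s)‖ ≤ C * |t - s| ^ (2 * β)}

/-- `(m, ζ0, ζ1)` is a delayed `(α, β, θ)`-controlled path based on `X` on `[a,b]`
(with delay `rr`). -/
def IsDelayedControlled (rr α β θ : ℝ) (X : ℝ → Fin d → ℝ) (a b : ℝ)
    (m : ℝ → E) (ζ0 ζ1 : ℝ → (Fin d → ℝ) →L[ℝ] E) : Prop :=
  HolderOn α (Icc a b) m ∧ HolderOn β (Icc a b) ζ0 ∧ HolderOn β (Icc a b) ζ1 ∧
    ∃ C : ℝ, ∀ s ∈ Icc a b, ∀ t ∈ Icc a b,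
      ‖m t - m s - ζ0 s (X t - X s) - ζ1 s (X (t - rr) - X (s - rr))‖ ≤ C * |t - s| ^ θ

/-- The norm on the space `𝒟_X^{α,β,θ}([a,b])` of delayed controlled paths. -/
def dcpNorm (rr α β θ : ℝ) (X : ℝ → Fin d → ℝ) (a b : ℝ)
    (m : ℝ → E) (ζ0 ζ1 : ℝ → (Fin d → ℝ) →L[ℝ] E) : ℝ :=
  ‖m a‖ + ‖ζ0 a‖ + ‖ζ1 a‖ + holderNorm α (Icc a b) m + holderNorm β (Icc a b) ζ0 +
    holderNorm β (Icc a b) ζ1 +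
    sInf {C : ℝ | 0 ≤ C ∧ ∀ s ∈ Icc a b, ∀ t ∈ Icc a b,
      ‖m t - m s - ζ0 s (X t - X s) - ζ1 s (X (t - rr) - X (s - rr))‖ ≤ C * |t - s| ^ θ}

/-- Application of a bilinear-map-valued coefficient to a tensor (matrix). -/
def apply2 (ζ : (Fin d → ℝ) →L[ℝ] ((Fin d → ℝ) →L[ℝ] E)) (M : Fin d → Fin d → ℝ) : E :=
  ∑ i : Fin d, ∑ j : Fin d, M i j • ζ (Pi.single i 1) (Pi.single j 1)

/-- A partition of the interval `[s,t]`. -/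
structure Partition (s t : ℝ) : Type where
  n : ℕ
  pts : ℕ → ℝ
  h0 : pts 0 = s
  hn : pts n = t
  mono : ∀ i < n, pts i ≤ pts (i + 1)

/-- The mesh of the partition is at most `δ`. -/
def Partition.MeshLE {s t : ℝ} (P : Partition s t) (δ : ℝ) : Prop :=
  ∀ i < P.n, P.pts (i + 1) - P.pts i ≤ δ

/-- The compensated Riemann sum of a delayed controlled integrand along a partition. -/
def riemannSum (RP : DelayedRoughPath d r γ) (m : ℝ → (Fin d → ℝ) →L[ℝ] E)
    (ζ0 ζ1 : ℝ → (Fin d → ℝ) →L[ℝ] ((Fin d → ℝ) →L[ℝ] E)) {s t : ℝ} (P : Partition s t) : E :=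
  ∑ i ∈ Finset.range P.n,
    (m (P.pts i) (RP.X (P.pts (i + 1)) - RP.X (P.pts i)) +
      apply2 (ζ0 (P.pts i)) (RP.XX (P.pts i) (P.pts (i + 1))) +
      apply2 (ζ1 (P.pts i)) (RP.XXd (P.pts i) (P.pts (i + 1))))

/-- `v` is the rough delay integral `∫_s^t m dX` of the delayed controlled path
`(m, ζ0, ζ1)` against `RP`: the compensated Riemann sums converge to `v` as the mesh
tends to zero. -/
def HasRoughIntegral (RP : DelayedRoughPath d r γ) (m : ℝ → (Fin d → ℝ) →L[ℝ] E)
    (ζ0 ζ1 : ℝ → (Fin d → ℝ) →L[ℝ] ((Fin d → ℝ) →L[ℝ] E)) (s t : ℝ) (v : E) : Prop :=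
  ∀ ε > (0:ℝ), ∃ δ > (0:ℝ), ∀ P : Partition s t, P.MeshLE δ → ‖riemannSum RP m ζ0 ζ1 P - v‖ ≤ ε

/-- Compensated Riemann sum for the (non-delayed) forward rough integral. -/
def riemannSumFwd (X : ℝ → Fin d → ℝ) (XX : ℝ → ℝ → Fin d → Fin d → ℝ)
    (m : ℝ → (Fin d → ℝ) →L[ℝ] E) (m' : ℝ → (Fin d → ℝ) →L[ℝ] ((Fin d → ℝ) →L[ℝ] E))
    {s t : ℝ} (P : Partition s t) : E :=
  ∑ i ∈ Finset.range P.n,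
    (m (P.pts i) (X (P.pts (i + 1)) - X (P.pts i)) +
      apply2 (m' (P.pts i)) (XX (P.pts i) (P.pts (i + 1))))

/-- The forward rough integral of a controlled path, via left-point compensated sums. -/
def HasFwdIntegral (X : ℝ → Fin d → ℝ) (XX : ℝ → ℝ → Fin d → Fin d → ℝ)
    (m : ℝ → (Fin d → ℝ) →L[ℝ] E) (m' : ℝ → (Fin d → ℝ) →L[ℝ] ((Fin d → ℝ) →L[ℝ] E))
    (s t : ℝ) (v : E) : Prop :=
  ∀ ε > (0:ℝ), ∃ δ > (0:ℝ), ∀ P : Partition s t, P.MeshLE δ →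
    ‖riemannSumFwd X XX m m' P - v‖ ≤ ε

/-- Compensated Riemann sum for the backward rough integral (right endpoints). -/
def riemannSumBwd (X : ℝ → Fin d → ℝ) (XX : ℝ → ℝ → Fin d → Fin d → ℝ)
    (m : ℝ → (Fin d → ℝ) →L[ℝ] E) (m' : ℝ → (Fin d → ℝ) →L[ℝ] ((Fin d → ℝ) →L[ℝ] E))
    {s t : ℝ} (P : Partition s t) : E :=
  ∑ i ∈ Finset.range P.n,
    (m (P.pts (i + 1)) (X (P.pts (i + 1)) - X (P.pts i)) +
      apply2 (m' (P.pts (i + 1))) (XX (P.pts i) (P.pts (i + 1))))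

/-- The backward rough integral, via right-point compensated sums. -/
def HasBwdIntegral (X : ℝ → Fin d → ℝ) (XX : ℝ → ℝ → Fin d → Fin d → ℝ)
    (m : ℝ → (Fin d → ℝ) →L[ℝ] E) (m' : ℝ → (Fin d → ℝ) →L[ℝ] ((Fin d → ℝ) →L[ℝ] E))
    (s t : ℝ) (v : E) : Prop :=
  ∀ ε > (0:ℝ), ∃ δ > (0:ℝ), ∀ P : Partition s t, P.MeshLE δ →
    ‖riemannSumBwd X XX m m' P - v‖ ≤ ε

end Controlled

section Smooth

variable [NormedAddCommGroup E₁] [NormedSpace ℝ E₁] [NormedAddCommGroup E₂] [NormedSpace ℝ E₂]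

/-- `f ∈ C^n_b`: `f` is `n` times continuously differentiable with bounded derivatives
(up to order `n`). -/
def CnBounded (n : ℕ) (f : E₁ → E₂) : Prop :=
  ContDiff ℝ n f ∧ ∀ i : ℕ, i ≤ n → ∃ C : ℝ, ∀ x, ‖iteratedFDeriv ℝ i f x‖ ≤ C

/-- `f ∈ 𝒞^{m+κ}`: derivatives up to order `m` are bounded and continuous and the
`m`-th derivative is `κ`-Hölder. -/
def CHolderClass (m : ℕ) (κ : ℝ) (f : E₁ → E₂) : Prop :=
  ContDiff ℝ m f ∧ (∀ i : ℕ, i ≤ m → ∃ C : ℝ, ∀ x, ‖iteratedFDeriv ℝ i f x‖ ≤ C) ∧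
    ∃ C : ℝ, ∀ x y, ‖iteratedFDeriv ℝ m f x - iteratedFDeriv ℝ m f y‖ ≤ C * ‖x - y‖ ^ κ

end Smooth

section CNdelta

variable {F₁ F₂ : Type*} [AddCommGroup F₁] [Module ℝ F₁] [AddCommGroup F₂] [Module ℝ F₂]

/-- A map `F` between (semi-)normed spaces (seminorms `N₁`, `N₂`) is of class `𝒞^{n+δ}`
on `U`: there exist multilinear derivative maps `D j`, `j ≤ n`, bounded with respect
to the seminorms, where `D (j+1)` is the Fréchet derivative of `D j` on `U` and `D n`
is `δ`-Hölder on `U`. -/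
def IsCNdeltaOn (N₁ : F₁ → ℝ) (N₂ : F₂ → ℝ) (F : F₁ → F₂) (U : Set F₁) (n : ℕ) (δ : ℝ) :
    Prop :=
  ∃ D : (j : ℕ) → F₁ → ((Fin j → F₁) → F₂),
    (∀ x ∈ U, ∀ v : Fin 0 → F₁, D 0 x v = F x) ∧
    (∀ j : ℕ, j ≤ n → ∀ x ∈ U, ∀ (v : Fin j → F₁) (i : Fin j) (a b : F₁) (c : ℝ),
      D j x (Function.update v i (a + b)) =
          D j x (Function.update v i a) + D j x (Function.update v i b) ∧
        D j x (Function.update v i (c • a)) = c • D j x (Function.update v i a)) ∧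
    (∀ j : ℕ, j ≤ n → ∀ x ∈ U, ∃ C : ℝ, ∀ v : Fin j → F₁,
      N₂ (D j x v) ≤ C * ∏ i : Fin j, N₁ (v i)) ∧
    (∀ j : ℕ, j < n → ∀ x ∈ U, ∀ ε > (0:ℝ), ∃ ρ > (0:ℝ), ∀ h : F₁, N₁ h ≤ ρ → x + h ∈ U →
      ∀ v : Fin j → F₁,
        N₂ (D j (x + h) v - D j x v - D (j + 1) x (Fin.cons h v)) ≤
          ε * N₁ h * ∏ i : Fin j, N₁ (v i)) ∧
    ∃ C : ℝ, ∀ x ∈ U, ∀ y ∈ U, ∀ v : Fin n → F₁,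
      N₂ (D n x v - D n y v) ≤ C * N₁ (x - y) ^ δ * ∏ i : Fin n, N₁ (v i)

/-- `F` is locally of class `𝒞^{n+δ}` on `S`. -/
def IsLocallyCNdeltaOn (N₁ : F₁ → ℝ) (N₂ : F₂ → ℝ) (F : F₁ → F₂) (S : Set F₁) (n : ℕ)
    (δ : ℝ) : Prop :=
  ∀ x ∈ S, ∃ ρ > (0:ℝ), IsCNdeltaOn N₁ N₂ F (S ∩ {y | N₁ (y - x) < ρ}) n δ

end CNdelta

section Equation

variable {W : Type*} [NormedAddCommGroup W] [NormedSpace ℝ W]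

/-- The partial derivative `σ_x` of `σ` in the first variable. -/
def sigmaX (σ : W × W → (Fin d → ℝ) →L[ℝ] W) : W × W → W →L[ℝ] ((Fin d → ℝ) →L[ℝ] W) :=
  fun p => (fderiv ℝ σ p).comp (ContinuousLinearMap.inl ℝ W W)

/-- The partial derivative `σ_y` of `σ` in the second variable. -/
def sigmaY (σ : W × W → (Fin d → ℝ) →L[ℝ] W) : W × W → W →L[ℝ] ((Fin d → ℝ) →L[ℝ] W) :=
  fun p => (fderiv ℝ σ p).comp (ContinuousLinearMap.inr ℝ W W)

/-- The Gubinelli derivative of a solution: `ξ'` on `[-r,0)`, `σ(y_t, y_{t-r})` for `t ≥ 0`. -/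
def solDeriv (σ : W × W → (Fin d → ℝ) →L[ℝ] W) (rr : ℝ)
    (ξ' : ℝ → (Fin d → ℝ) →L[ℝ] W) (y : ℝ → W) : ℝ → (Fin d → ℝ) →L[ℝ] W :=
  fun t => if t < 0 then ξ' t else σ (y t, y (t - rr))

/-- `ζ⁰` component of the integrand `τ ↦ σ(y_τ, y_{τ-r})`:  `σ_x(y_τ, y_{τ-r}) y'_τ`. -/
def zeta0 (σ : W × W → (Fin d → ℝ) →L[ℝ] W) (rr : ℝ) (y : ℝ → W)
    (y' : ℝ → (Fin d → ℝ) →L[ℝ] W) : ℝ → (Fin d → ℝ) →L[ℝ] ((Fin d → ℝ) →L[ℝ] W) :=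
  fun τ => (sigmaX σ (y τ, y (τ - rr))).comp (y' τ)

/-- `ζ¹` component of the integrand `τ ↦ σ(y_τ, y_{τ-r})`:  `σ_y(y_τ, y_{τ-r}) y'_{τ-r}`. -/
def zeta1 (σ : W × W → (Fin d → ℝ) →L[ℝ] W) (rr : ℝ) (y : ℝ → W)
    (y' : ℝ → (Fin d → ℝ) →L[ℝ] W) : ℝ → (Fin d → ℝ) →L[ℝ] ((Fin d → ℝ) →L[ℝ] W) :=
  fun τ => (sigmaY σ (y τ, y (τ - rr))).comp (y' (τ - rr))

/-- `y` solves `dy_t = B(y_t, y_{t-r}) dt + σ(y_t, y_{t-r}) dRP_t` on `[0,T]` with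
initial condition `(ξ, ξ')` on `[-r,0]`:  `y = ξ` on `[-r,0]`, on each interval
`[kr, (k+1)r] ∩ [0,T]` the path is `β`-controlled with Gubinelli derivative
`y'_t = σ(y_t, y_{t-r})`, and the integral identity holds for `0 ≤ s ≤ t ≤ T`. -/
def IsSolOnT (RP : DelayedRoughPath d r γ) (σ : W × W → (Fin d → ℝ) →L[ℝ] W)
    (B : W × W →ₗ[ℝ] W) (β : ℝ) (ξ : ℝ → W) (ξ' : ℝ → (Fin d → ℝ) →L[ℝ] W)
    (T : ℝ) (y : ℝ → W) : Prop :=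
  (∀ t ∈ Icc (-r) 0, y t = ξ t) ∧
    (∀ k : ℕ, (k : ℝ) * r ≤ T →
      IsControlled β RP.X (Icc ((k : ℝ) * r) (min (((k : ℝ) + 1) * r) T)) y
        (solDeriv σ r ξ' y)) ∧
    ∀ s t : ℝ, 0 ≤ s → s ≤ t → t ≤ T →
      HasRoughIntegral RP (fun τ => σ (y τ, y (τ - r)))
        (zeta0 σ r y (solDeriv σ r ξ' y)) (zeta1 σ r y (solDeriv σ r ξ' y)) s t
        (y t - y s - ∫ τ in s..t, B (y τ, y (τ - r)))

/-- `y` solves `dy_t = B(y_t, y_{t-r}) dt + σ(y_t, y_{t-r}) dRP_t` on `[0,r]` with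
initial condition `(ξ, ξ')` on `[-r,0]`. -/
def IsSolOn (RP : DelayedRoughPath d r γ) (σ : W × W → (Fin d → ℝ) →L[ℝ] W)
    (B : W × W →ₗ[ℝ] W) (β : ℝ) (ξ : ℝ → W) (ξ' : ℝ → (Fin d → ℝ) →L[ℝ] W)
    (y : ℝ → W) : Prop :=
  (∀ t ∈ Icc (-r) 0, y t = ξ t) ∧
    IsControlled β RP.X (Icc 0 r) y (solDeriv σ r ξ' y) ∧
    ∀ t ∈ Icc 0 r,
      HasRoughIntegral RP (fun τ => σ (y τ, y (τ - r)))
        (zeta0 σ r y (solDeriv σ r ξ' y)) (zeta1 σ r y (solDeriv σ r ξ' y)) 0 t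
        (y t - ξ 0 - ∫ τ in (0:ℝ)..t, B (y τ, y (τ - r)))

/-- The solution map `ξ ↦ y^ξ` on pairs (path, Gubinelli derivative). -/
def solMap (RP : DelayedRoughPath d r γ) (σ : W × W → (Fin d → ℝ) →L[ℝ] W)
    (B : W × W →ₗ[ℝ] W) (β : ℝ) :
    ((ℝ → W) × (ℝ → (Fin d → ℝ) →L[ℝ] W)) → ((ℝ → W) × (ℝ → (Fin d → ℝ) →L[ℝ] W)) :=
  fun p =>
    @dite _ (∃ y : ℝ → W, IsSolOn RP σ B β p.1 p.2 y) (Classical.dec _)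
      (fun h => (h.choose, solDeriv σ r p.2 h.choose)) (fun _ => 0)

/-- `D` is the Fréchet derivative of the solution map at the controlled path `p`:
`D` is a bounded linear map (w.r.t. the controlled path norms) and
`‖solMap (p+h) - solMap p - D h‖ = o(‖h‖)` on controlled directions `h`. -/
def IsSolMapDerivAt (RP : DelayedRoughPath d r γ) (σ : W × W → (Fin d → ℝ) →L[ℝ] W)
    (B : W × W →ₗ[ℝ] W) (β : ℝ) (p : (ℝ → W) × (ℝ → (Fin d → ℝ) →L[ℝ] W))
    (D : ((ℝ → W) × (ℝ → (Fin d → ℝ) →L[ℝ] W)) →ₗ[ℝ]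
      ((ℝ → W) × (ℝ → (Fin d → ℝ) →L[ℝ] W))) : Prop :=
  (∃ C : ℝ, 0 ≤ C ∧ ∀ q : (ℝ → W) × (ℝ → (Fin d → ℝ) →L[ℝ] W),
    IsControlled β RP.X (Icc (-r) 0) q.1 q.2 →
      cpNorm β RP.X 0 r (D q).1 (D q).2 ≤ C * cpNorm β RP.X (-r) 0 q.1 q.2) ∧
    ∀ ε > (0:ℝ), ∃ δ > (0:ℝ), ∀ h : (ℝ → W) × (ℝ → (Fin d → ℝ) →L[ℝ] W),
      IsControlled β RP.X (Icc (-r) 0) h.1 h.2 → cpNorm β RP.X (-r) 0 h.1 h.2 ≤ δ →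
        cpNorm β RP.X 0 r (solMap RP σ B β (p + h) - solMap RP σ B β p - D h).1
            (solMap RP σ B β (p + h) - solMap RP σ B β p - D h).2 ≤
          ε * cpNorm β RP.X (-r) 0 h.1 h.2

/-- The map `(a,b,c,e) ↦ σ_x(a,b) c + σ_y(a,b) e` appearing in the linearized equation. -/
def PhiLin (σ : W × W → (Fin d → ℝ) →L[ℝ] W) : W × W × W × W → (Fin d → ℝ) →L[ℝ] W :=
  fun p => sigmaX σ (p.1, p.2.1) p.2.2.1 + sigmaY σ (p.1, p.2.1) p.2.2.2

/-- The integrand `τ ↦ σ_x(y_τ, ξ_{τ-r}) Z_τ + σ_y(y_τ, ξ_{τ-r}) η_{τ-r}` of the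
linearized equation. -/
def linInt (σ : W × W → (Fin d → ℝ) →L[ℝ] W) (rr : ℝ) (ξ y Z ηf : ℝ → W) :
    ℝ → (Fin d → ℝ) →L[ℝ] W :=
  fun τ => sigmaX σ (y τ, ξ (τ - rr)) (Z τ) + sigmaY σ (y τ, ξ (τ - rr)) (ηf (τ - rr))

/-- The `ζ⁰` component of the linearized integrand, via the Leibniz rule. -/
def zeta0lin (σ : W × W → (Fin d → ℝ) →L[ℝ] W) (rr : ℝ) (ξ y Z ηf : ℝ → W)
    (y' Z' : ℝ → (Fin d → ℝ) →L[ℝ] W) : ℝ → (Fin d → ℝ) →L[ℝ] ((Fin d → ℝ) →L[ℝ] W) :=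
  fun τ => (fderiv ℝ (PhiLin σ) (y τ, ξ (τ - rr), Z τ, ηf (τ - rr))).comp
    ((y' τ).prod (((0 : (Fin d → ℝ) →L[ℝ] W)).prod ((Z' τ).prod (0 : (Fin d → ℝ) →L[ℝ] W))))

/-- The `ζ¹` component of the linearized integrand, via the Leibniz rule. -/
def zeta1lin (σ : W × W → (Fin d → ℝ) →L[ℝ] W) (rr : ℝ) (ξ y Z ηf : ℝ → W)
    (ξ' η' : ℝ → (Fin d → ℝ) →L[ℝ] W) : ℝ → (Fin d → ℝ) →L[ℝ] ((Fin d → ℝ) →L[ℝ] W) :=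
  fun τ => (fderiv ℝ (PhiLin σ) (y τ, ξ (τ - rr), Z τ, ηf (τ - rr))).comp
    (((0 : (Fin d → ℝ) →L[ℝ] W)).prod
      ((ξ' (τ - rr)).prod (((0 : (Fin d → ℝ) →L[ℝ] W)).prod (η' (τ - rr)))))

/-- `Z` solves the linearized rough delay equation along `y = y^ξ` in the direction
`(η, η')`, i.e. `Z_t = η_0 + ∫_0^t B(Z_τ, η_{τ-r}) dτ
 + ∫_0^t [σ_x(y_τ, ξ_{τ-r}) Z_τ + σ_y(y_τ, ξ_{τ-r}) η_{τ-r}] dRP_τ` on `[0,r]`,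
`Z = η` on `[-r,0]`, with the Gubinelli derivative given by the integrand. -/
def IsLinSolOn (RP : DelayedRoughPath d r γ) (σ : W × W → (Fin d → ℝ) →L[ℝ] W)
    (B : W × W →ₗ[ℝ] W) (β : ℝ) (ξ ηf : ℝ → W) (ξ' η' : ℝ → (Fin d → ℝ) →L[ℝ] W)
    (y : ℝ → W) (Z : ℝ → W) : Prop :=
  (∀ t ∈ Icc (-r) 0, Z t = ηf t) ∧
    IsControlled β RP.X (Icc 0 r) Z
      (fun τ => if τ < 0 then η' τ else linInt σ r ξ y Z ηf τ) ∧
    ∀ t ∈ Icc 0 r,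
      HasRoughIntegral RP (linInt σ r ξ y Z ηf)
        (zeta0lin σ r ξ y Z ηf (solDeriv σ r ξ' y)
          (fun τ => if τ < 0 then η' τ else linInt σ r ξ y Z ηf τ))
        (zeta1lin σ r ξ y Z ηf ξ' η') 0 t
        (Z t - ηf 0 - ∫ τ in (0:ℝ)..t, B (Z τ, ηf (τ - r)))

/-- `y` solves the frozen-delay equation `y_t = x + ∫_s^t σ(y_τ, ξ_{τ-r}) dRP_τ` on `[s,r]`
with Gubinelli derivative `σ(y_·, ξ_{·-r})`. -/
def IsFrozenSol (RP : DelayedRoughPath d r γ) (σ : W × W → (Fin d → ℝ) →L[ℝ] W) (β : ℝ)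
    (ξ : ℝ → W) (ξ' : ℝ → (Fin d → ℝ) →L[ℝ] W) (s : ℝ) (x : W) (y : ℝ → W) : Prop :=
  y s = x ∧
    IsControlled β RP.X (Icc s r) y (fun τ => σ (y τ, ξ (τ - r))) ∧
    ∀ t ∈ Icc s r,
      HasRoughIntegral RP (fun τ => σ (y τ, ξ (τ - r)))
        (fun τ => (sigmaX σ (y τ, ξ (τ - r))).comp (σ (y τ, ξ (τ - r))))
        (fun τ => (sigmaY σ (y τ, ξ (τ - r))).comp (ξ' (τ - r))) s t (y t - x)

/-- The solution flow `φ̄(s, ·, x)` of the frozen-delay equation. -/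
def frozenFlow (RP : DelayedRoughPath d r γ) (σ : W × W → (Fin d → ℝ) →L[ℝ] W) (β : ℝ)
    (ξ : ℝ → W) (ξ' : ℝ → (Fin d → ℝ) →L[ℝ] W) (s : ℝ) (x : W) : ℝ → W :=
  @dite _ (∃ y : ℝ → W, IsFrozenSol RP σ β ξ ξ' s x y) (Classical.dec _)
    (fun h => h.choose) (fun _ => fun _ => x)

end Equation

end SDDE

namespace SewAux

open SDDE Set Filter Topology

/-- Young-type maximal inequality along a monotone sequence. -/
theorem young_max {W : Type*} [NormedAddCommGroup W] (Ξ : ℝ → ℝ → W) (a b K p C : ℝ)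
    (hK : 0 ≤ K) (hp : 0 < p) (hC : 0 ≤ C) (hCp : 2 * (C * (1 / 2 : ℝ) ^ p) + 2 ≤ C)
    (hΞ : ∀ s u t, a ≤ s → s ≤ u → u ≤ t → t ≤ b →
      ‖Ξ s t - Ξ s u - Ξ u t‖ ≤ K * (t - s) ^ p)
    (g : ℕ → ℝ) (hg : Monotone g) (hgI : ∀ i, g i ∈ Icc a b) :
    ∀ n j k : ℕ, j ≤ k → k - j ≤ n →
      ‖∑ i ∈ Finset.Ico j k, Ξ (g i) (g (i + 1)) - Ξ (g j) (g k)‖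
        ≤ C * K * (g k - g j) ^ p := by
  intro n
  have hdiag : ∀ x, x ∈ Icc a b → Ξ x x = 0 := by
    intro x hx
    have := hΞ x x x hx.1 le_rfl le_rfl hx.2
    rw [sub_self (x : ℝ), Real.zero_rpow hp.ne'] at this
    simpa using this
  induction n with
  | zero =>
    intro j k hjk hn
    have : j = k := by omega
    subst this
    simp [hdiag _ (hgI j), Real.zero_rpow hp.ne']
  | succ n ih =>
    intro j k hjk hn
    rcases hjk.eq_or_lt with h | hlt
    · subst h
      simp [hdiag _ (hgI j), Real.zero_rpow hp.ne']
    classical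
    set ω := g k - g j with hω
    have hω0 : 0 ≤ ω := sub_nonneg.2 (hg hjk)
    have hex : ∃ l, j ≤ l ∧ g k - g (l + 1) ≤ ω / 2 := by
      refine ⟨k - 1, by omega, ?_⟩
      rw [Nat.sub_add_cancel (by omega)]
      linarith
    obtain ⟨l, hjl, hlk, h1, h2⟩ : ∃ l, j ≤ l ∧ l < k ∧ g l - g j ≤ ω / 2 ∧
        g k - g (l + 1) ≤ ω / 2 := by
      have hs := Nat.find_spec hex
      have hm : Nat.find hex ≤ k - 1 := by
        apply Nat.find_min' hex
        refine ⟨by omega, ?_⟩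
        rw [Nat.sub_add_cancel (by omega)]
        linarith
      refine ⟨Nat.find hex, hs.1, by omega, ?_, hs.2⟩
      rcases hs.1.eq_or_lt with h | h
      · rw [← h]; linarith
      · have hh := Nat.find_min hex (m := Nat.find hex - 1) (by omega)
        have : ¬ (g k - g (Nat.find hex) ≤ ω / 2) := by
          intro h3
          apply hh
          refine ⟨by omega, ?_⟩
          rwa [Nat.sub_add_cancel (by omega)]
        push Not at this
        linarith
    have hgjl := hg hjl
    have hgl1 : g l ≤ g (l + 1) := hg (Nat.le_succ l)
    have hgl1k : g (l + 1) ≤ g k := hg hlk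
    have e1 := ih j l hjl (by omega)
    have e2 := ih (l + 1) k hlk (by omega)
    have d1 := hΞ (g j) (g l) (g k) (hgI j).1 hgjl (hgl1.trans hgl1k) (hgI k).2
    have d2 := hΞ (g l) (g (l + 1)) (g k) (hgI l).1 hgl1 hgl1k (hgI k).2
    have hhalf : (ω / 2) ^ p = (1 / 2 : ℝ) ^ p * ω ^ p := by
      rw [← Real.mul_rpow (by norm_num) hω0]; congr 1; ring
    have q1 : (g l - g j) ^ p ≤ (1 / 2 : ℝ) ^ p * ω ^ p := by
      rw [← hhalf]; exact Real.rpow_le_rpow (by linarith) h1 hp.le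
    have q2 : (g k - g (l + 1)) ^ p ≤ (1 / 2 : ℝ) ^ p * ω ^ p := by
      rw [← hhalf]; exact Real.rpow_le_rpow (by linarith) h2 hp.le
    have q3 : (g k - g l) ^ p ≤ ω ^ p :=
      Real.rpow_le_rpow (by linarith) (by linarith) hp.le
    have hωp : 0 ≤ ω ^ p := Real.rpow_nonneg hω0 p
    have hsum : ∑ i ∈ Finset.Ico j k, Ξ (g i) (g (i + 1)) =
        ∑ i ∈ Finset.Ico j l, Ξ (g i) (g (i + 1)) + Ξ (g l) (g (l + 1)) +
          ∑ i ∈ Finset.Ico (l + 1) k, Ξ (g i) (g (i + 1)) := by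
      rw [← Finset.sum_Ico_succ_top hjl, Finset.sum_Ico_consecutive _ (by omega) (by omega)]
    rw [hsum]
    set S1 := ∑ i ∈ Finset.Ico j l, Ξ (g i) (g (i + 1))
    set S2 := ∑ i ∈ Finset.Ico (l + 1) k, Ξ (g i) (g (i + 1))
    have key : S1 + Ξ (g l) (g (l + 1)) + S2 - Ξ (g j) (g k) =
        (S1 - Ξ (g j) (g l)) + (S2 - Ξ (g (l + 1)) (g k))
        - (Ξ (g j) (g k) - Ξ (g j) (g l) - Ξ (g l) (g k))
        - (Ξ (g l) (g k) - Ξ (g l) (g (l + 1)) - Ξ (g (l + 1)) (g k)) := by abel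
    rw [key]
    have hCK : 0 ≤ C * K := mul_nonneg hC hK
    calc _ ≤ ‖S1 - Ξ (g j) (g l)‖ + ‖S2 - Ξ (g (l + 1)) (g k)‖
        + ‖Ξ (g j) (g k) - Ξ (g j) (g l) - Ξ (g l) (g k)‖
        + ‖Ξ (g l) (g k) - Ξ (g l) (g (l + 1)) - Ξ (g (l + 1)) (g k)‖ :=
          (norm_sub_le _ _).trans (add_le_add_left ((norm_sub_le _ _).trans
            (add_le_add_left (norm_add_le _ _) _)) _)
      _ ≤ C * K * ((1 / 2 : ℝ) ^ p * ω ^ p) + C * K * ((1 / 2 : ℝ) ^ p * ω ^ p)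
          + K * ω ^ p + K * ω ^ p := by
          gcongr
          · exact e1.trans (mul_le_mul_of_nonneg_left q1 hCK)
          · exact e2.trans (mul_le_mul_of_nonneg_left q2 hCK)
          · exact d2.trans (mul_le_mul_of_nonneg_left q3 hK)
      _ = (2 * (C * (1 / 2 : ℝ) ^ p) + 2) * (K * ω ^ p) := by ring
      _ ≤ C * (K * ω ^ p) := mul_le_mul_of_nonneg_right hCp (mul_nonneg hK hωp)
      _ = _ := by ring

theorem exists_enum (a : ℝ) (F : Finset ℝ) (hF : ∀ x ∈ F, a ≤ x) :
    ∃ (g : ℕ → ℝ) (N : ℕ), Monotone g ∧ (∀ i, g i = a ∨ g i ∈ F) ∧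
      ∀ x ∈ F, ∃ i ≤ N, g i = x := by
  induction F using Finset.induction_on_max with
  | empty => exact ⟨fun _ => a, 0, monotone_const, fun _ => Or.inl rfl, by simp⟩
  | insert x F hx ih =>
    obtain ⟨g, N, hg, hgm, hgF⟩ := ih (fun y hy => hF y (Finset.mem_insert_of_mem hy))
    have hax : a ≤ x := hF x (Finset.mem_insert_self _ _)
    have hgx : ∀ i, g i ≤ x := by
      intro i
      rcases hgm i with h | h
      · rw [h]; exact hax
      · exact (hx _ h).le
    refine ⟨fun i => if i ≤ N then g i else x, N + 1, ?_, ?_, ?_⟩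
    · intro i j hij
      dsimp only
      split_ifs with h1 h2 h2
      · exact hg hij
      · exact hgx i
      · omega
      · exact le_rfl
    · intro i
      dsimp only
      split_ifs with h1
      · rcases hgm i with h | h
        · exact Or.inl h
        · exact Or.inr (Finset.mem_insert_of_mem h)
      · exact Or.inr (Finset.mem_insert_self _ _)
    · intro y hy
      rcases Finset.mem_insert.1 hy with h | h
      · exact ⟨N + 1, le_rfl, by simp [h]⟩
      · obtain ⟨i, hi, hiy⟩ := hgF y h
        exact ⟨i, by omega, by simp [hi, hiy]⟩

theorem finite_sewing {W : Type*} [NormedAddCommGroup W] (Ξ : ℝ → ℝ → W) (a b K p C : ℝ)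
    (hab : a ≤ b)
    (hK : 0 ≤ K) (hp : 0 < p) (hC : 0 ≤ C) (hCp : 2 * (C * (1 / 2 : ℝ) ^ p) + 2 ≤ C)
    (hΞ : ∀ s u t, a ≤ s → s ≤ u → u ≤ t → t ≤ b →
      ‖Ξ s t - Ξ s u - Ξ u t‖ ≤ K * (t - s) ^ p) (F : Finset ℝ) :
    ∃ f : ℝ → W, f a = 0 ∧ ∀ s ∈ F, ∀ t ∈ F, a ≤ s → s ≤ t → t ≤ b →
      ‖f t - f s - Ξ s t‖ ≤ C * K * (t - s) ^ p := by
  classical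
  obtain ⟨g, N, hg, hgm, hgF⟩ := exists_enum a (F.filter (fun x => x ∈ Icc a b))
    (fun x hx => (Finset.mem_filter.1 hx).2.1)
  have hgI : ∀ i, g i ∈ Icc a b := by
    intro i
    rcases hgm i with h | h
    · rw [h]; exact ⟨le_rfl, hab⟩
    · exact (Finset.mem_filter.1 h).2
  have hidx : ∀ x, ∃ i, x ∈ F → x ∈ Icc a b → g i = x := by
    intro x
    by_cases h : x ∈ F ∧ x ∈ Icc a b
    · obtain ⟨i, -, hi⟩ := hgF x (Finset.mem_filter.2 h)
      exact ⟨i, fun _ _ => hi⟩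
    · exact ⟨0, fun h1 h2 => absurd ⟨h1, h2⟩ h⟩
  choose ι hι using hidx
  let f0 : ℝ → W := fun t => ∑ i ∈ Finset.range (ι t), Ξ (g i) (g (i + 1))
  refine ⟨fun t => f0 t - f0 a, sub_self _, ?_⟩
  intro s hs t ht has hst htb
  have es := hι s hs ⟨has, hst.trans htb⟩
  have et := hι t ht ⟨has.trans hst, htb⟩
  have hle : ι s ≤ ι t := by
    by_contra h
    push Not at h
    have h1 := hg h.le
    rw [es, et] at h1
    have : s = t := le_antisymm hst h1
    subst this
    exact lt_irrefl _ h
  have := young_max Ξ a b K p C hK hp hC hCp hΞ g hg hgI (ι t - ι s) (ι s) (ι t) hle le_rfl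
  rw [es, et, Finset.sum_Ico_eq_sub _ hle] at this
  have e : f0 t - f0 a - (f0 s - f0 a) - Ξ s t = f0 t - f0 s - Ξ s t := by abel
  dsimp only
  rw [e]
  exact this

theorem sewing {W : Type*} [NormedAddCommGroup W] [ProperSpace W]
    (Ξ : ℝ → ℝ → W) (a b K p C : ℝ)
    (hab : a ≤ b)
    (hK : 0 ≤ K) (hp : 0 < p) (hC : 0 ≤ C) (hCp : 2 * (C * (1 / 2 : ℝ) ^ p) + 2 ≤ C)
    (hΞ : ∀ s u t, a ≤ s → s ≤ u → u ≤ t → t ≤ b →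
      ‖Ξ s t - Ξ s u - Ξ u t‖ ≤ K * (t - s) ^ p) :
    ∃ f : ℝ → W, f a = 0 ∧ ∀ s t, a ≤ s → s ≤ t → t ≤ b →
      ‖f t - f s - Ξ s t‖ ≤ C * K * (t - s) ^ p := by
  classical
  choose f hfa hf using finite_sewing Ξ a b K p C hab hK hp hC hCp hΞ
  let U : Ultrafilter (Finset ℝ) := Ultrafilter.of atTop
  have hU : (U : Filter (Finset ℝ)) ≤ atTop := Ultrafilter.of_le _
  have hmem : ∀ x : ℝ, ∀ᶠ F in (U : Filter (Finset ℝ)), x ∈ F := by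
    intro x
    apply hU
    filter_upwards [eventually_ge_atTop ({x} : Finset ℝ)] with F hF
    exact hF (Finset.mem_singleton_self x)
  have hlim : ∀ t, ∃ v, t ∈ Icc a b → Tendsto (fun F => f F t) U (𝓝 v) := by
    intro t
    by_cases ht : t ∈ Icc a b
    · have hb : ∀ᶠ F in (U : Filter (Finset ℝ)),
          f F t ∈ Metric.closedBall (Ξ a t) (C * K * (t - a) ^ p) := by
        filter_upwards [hmem a, hmem t] with F h1 h2
        have := hf F a h1 t h2 le_rfl ht.1 ht.2
        rw [hfa, sub_zero] at this
        rwa [mem_closedBall_iff_norm]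
      obtain ⟨v, -, hv⟩ := (isCompact_closedBall (Ξ a t) (C * K * (t - a) ^ p)).ultrafilter_le_nhds
        (U.map (fun F => f F t)) (le_principal_iff.2 hb)
      exact ⟨v, fun _ => hv⟩
    · exact ⟨0, fun h => absurd h ht⟩
  choose J hJ using hlim
  have hres : ∀ s t, a ≤ s → s ≤ t → t ≤ b →
      ‖J t - J s - Ξ s t‖ ≤ C * K * (t - s) ^ p := by
    intro s t has hst htb
    have T := ((hJ t ⟨has.trans hst, htb⟩).sub (hJ s ⟨has, hst.trans htb⟩)).sub_const (Ξ s t)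
    refine le_of_tendsto T.norm ?_
    filter_upwards [hmem s, hmem t] with F h1 h2
    exact hf F s h1 t h2 has hst htb
  refine ⟨fun t => J t - J a, sub_self _, ?_⟩
  intro s t has hst htb
  have := hres s t has hst htb
  simpa using this

theorem part_mem {s t : ℝ} (P : Partition s t) : ∀ i ≤ P.n, P.pts i ∈ Icc s t := by
  have hup : ∀ i ≤ P.n, s ≤ P.pts i := by
    intro i
    induction i with
    | zero => intro _; rw [P.h0]
    | succ i ih => intro h; exact (ih (by omega)).trans (P.mono i (by omega))
  have hdn : ∀ k, k ≤ P.n → P.pts (P.n - k) ≤ t := by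
    intro k
    induction k with
    | zero => intro _; rw [Nat.sub_zero, P.hn]
    | succ k ih =>
      intro h
      have h1 := P.mono (P.n - (k + 1)) (by omega)
      rw [show P.n - (k + 1) + 1 = P.n - k by omega] at h1
      exact h1.trans (ih (by omega))
  intro i hi
  refine ⟨hup i hi, ?_⟩
  have := hdn (P.n - i) (by omega)
  rwa [show P.n - (P.n - i) = i by omega] at this

/-- Local approximation implies convergence of Riemann sums. -/
theorem riemann_conv {W : Type*} [NormedAddCommGroup W]
    (Ξ : ℝ → ℝ → W) (f : ℝ → W) (a b D p : ℝ) (hD : 0 ≤ D) (hp : 1 < p)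
    (hf : ∀ s t, a ≤ s → s ≤ t → t ≤ b → ‖f t - f s - Ξ s t‖ ≤ D * (t - s) ^ p)
    (s t : ℝ) (has : a ≤ s) (hst : s ≤ t) (htb : t ≤ b) :
    ∀ ε > (0:ℝ), ∃ δ > (0:ℝ), ∀ P : Partition s t, P.MeshLE δ →
      ‖∑ i ∈ Finset.range P.n, Ξ (P.pts i) (P.pts (i + 1)) - (f t - f s)‖ ≤ ε := by
  intro ε hε
  have hM : 0 < D * (t - s) + 1 := by
    have := mul_nonneg hD (sub_nonneg.2 hst); linarith
  refine ⟨(ε / (D * (t - s) + 1)) ^ (1 / (p - 1)), by positivity, ?_⟩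
  intro P hP
  set δ := (ε / (D * (t - s) + 1)) ^ (1 / (p - 1)) with hδ
  have hδp : δ ^ (p - 1) = ε / (D * (t - s) + 1) := by
    rw [hδ, ← Real.rpow_mul (by positivity), one_div_mul_cancel (by linarith), Real.rpow_one]
  have htel : f t - f s = ∑ i ∈ Finset.range P.n, (f (P.pts (i + 1)) - f (P.pts i)) := by
    rw [Finset.sum_range_sub (fun i => f (P.pts i)), P.h0, P.hn]
  have htel2 : t - s = ∑ i ∈ Finset.range P.n, (P.pts (i + 1) - P.pts i) := by
    rw [Finset.sum_range_sub (fun i => P.pts i), P.h0, P.hn]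
  rw [norm_sub_rev, htel, ← Finset.sum_sub_distrib]
  have hδ0 : 0 < δ := by positivity
  calc _ ≤ ∑ i ∈ Finset.range P.n, D * (δ ^ (p - 1) * (P.pts (i + 1) - P.pts i)) := by
        refine norm_sum_le_of_le _ ?_
        intro i hi
        have hi' := Finset.mem_range.1 hi
        have m1 := part_mem P i hi'.le
        have m2 := part_mem P (i + 1) hi'
        have hmono := P.mono i hi'
        refine (hf _ _ (has.trans m1.1) hmono (m2.2.trans htb)).trans ?_
        refine mul_le_mul_of_nonneg_left ?_ hD
        set x := P.pts (i + 1) - P.pts i with hx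
        have hx0 : 0 ≤ x := sub_nonneg.2 hmono
        have : x ^ p = x ^ (p - 1) * x := by
          rcases hx0.eq_or_lt with h | h
          · rw [← h, Real.zero_rpow (by linarith)]; simp
          · rw [← Real.rpow_add_one h.ne']; congr 1; ring
        rw [this]
        exact mul_le_mul_of_nonneg_right
          (Real.rpow_le_rpow hx0 (hP i hi') (by linarith)) hx0
    _ = D * (t - s) * δ ^ (p - 1) := by
        rw [htel2, ← Finset.mul_sum, ← Finset.mul_sum]; ring
    _ ≤ ε := by
        rw [hδp, mul_div_assoc', div_le_iff₀ hM]
        nlinarith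

theorem exists_partition {s t : ℝ} (hst : s ≤ t) (δ : ℝ) (hδ : 0 < δ) :
    ∃ P : Partition s t, P.MeshLE δ := by
  obtain ⟨n, hn⟩ := exists_nat_gt ((t - s) / δ)
  have hts : 0 ≤ t - s := sub_nonneg.2 hst
  have hn0 : (0 : ℝ) < n := lt_of_le_of_lt (by positivity) hn
  refine ⟨⟨n, fun i => s + i * ((t - s) / n), by simp, by field_simp; ring, ?_⟩, ?_⟩
  · intro i _
    have : 0 ≤ (t - s) / n := by positivity
    push_cast
    linarith
  · intro i _
    dsimp only
    have h1 : (t - s) / n ≤ δ := by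
      rw [div_le_iff₀ hn0]
      rw [div_lt_iff₀ hδ] at hn
      linarith
    push_cast
    linarith

theorem integral_unique {d : ℕ} {r γ : ℝ} {W : Type*} [NormedAddCommGroup W] [NormedSpace ℝ W]
    (RP : DelayedRoughPath d r γ) (m : ℝ → (Fin d → ℝ) →L[ℝ] W)
    (ζ0 ζ1 : ℝ → (Fin d → ℝ) →L[ℝ] ((Fin d → ℝ) →L[ℝ] W)) (s t : ℝ) (hst : s ≤ t) (v w : W)
    (hv : HasRoughIntegral RP m ζ0 ζ1 s t v) (hw : HasRoughIntegral RP m ζ0 ζ1 s t w) :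
    v = w := by
  rw [← sub_eq_zero, ← norm_le_zero_iff]
  refine le_of_forall_pos_le_add ?_
  intro ε hε
  obtain ⟨δ1, h1, hv⟩ := hv (ε / 2) (by linarith)
  obtain ⟨δ2, h2, hw⟩ := hw (ε / 2) (by linarith)
  obtain ⟨P, hP⟩ := exists_partition hst (min δ1 δ2) (lt_min h1 h2)
  have e1 := hv P (fun i hi => (hP i hi).trans (min_le_left _ _))
  have e2 := hw P (fun i hi => (hP i hi).trans (min_le_right _ _))
  have : v - w = (riemannSum RP m ζ0 ζ1 P - w) - (riemannSum RP m ζ0 ζ1 P - v) := by abel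
  rw [this]
  exact (norm_sub_le _ _).trans (by linarith)

section apply2
variable {d : ℕ} {W : Type*} [NormedAddCommGroup W] [NormedSpace ℝ W]

theorem apply2_add (ζ : (Fin d → ℝ) →L[ℝ] ((Fin d → ℝ) →L[ℝ] W)) (M M' : Fin d → Fin d → ℝ) :
    apply2 ζ (M + M') = apply2 ζ M + apply2 ζ M' := by
  simp [apply2, add_smul, Finset.sum_add_distrib]

theorem apply2_sub_left (ζ ζ' : (Fin d → ℝ) →L[ℝ] ((Fin d → ℝ) →L[ℝ] W))
    (M : Fin d → Fin d → ℝ) :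
    apply2 (ζ - ζ') M = apply2 ζ M - apply2 ζ' M := by
  simp [apply2, smul_sub, Finset.sum_sub_distrib]

theorem apply2_tensor (ζ : (Fin d → ℝ) →L[ℝ] ((Fin d → ℝ) →L[ℝ] W)) (x y : Fin d → ℝ) :
    apply2 ζ (fun i j => x i * y j) = ζ x y := by
  have hx : x = ∑ i, x i • (Pi.single i (1 : ℝ) : Fin d → ℝ) := by
    simpa using pi_eq_sum_univ' x
  have hy : y = ∑ i, y i • (Pi.single i (1 : ℝ) : Fin d → ℝ) := by
    simpa using pi_eq_sum_univ' y
  conv_rhs => rw [hx, hy]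
  simp only [apply2, map_sum, map_smul, sum_apply,
    smul_apply, Finset.smul_sum, mul_smul]
  rw [Finset.sum_comm]
  exact Finset.sum_congr rfl fun j _ => Finset.sum_congr rfl fun i _ => smul_comm _ _ _

theorem norm_apply2_le (ζ : (Fin d → ℝ) →L[ℝ] ((Fin d → ℝ) →L[ℝ] W)) (M : Fin d → Fin d → ℝ) :
    ‖apply2 ζ M‖ ≤ (d : ℝ) * d * (‖ζ‖ * ‖M‖) := by
  have : ∀ i j, ‖M i j • ζ (Pi.single i 1) (Pi.single j 1)‖ ≤ ‖ζ‖ * ‖M‖ := by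
    intro i j
    rw [norm_smul, mul_comm]
    have h1 : ‖M i j‖ ≤ ‖M‖ := (norm_le_pi_norm (M i) j).trans (norm_le_pi_norm M i)
    have h2 : ‖ζ (Pi.single i 1) (Pi.single j 1)‖ ≤ ‖ζ‖ := by
      refine (ContinuousLinearMap.le_opNorm₂ ζ _ _).trans ?_
      simp [Pi.norm_single]
    exact mul_le_mul h2 h1 (norm_nonneg _) (ContinuousLinearMap.opNorm_nonneg ζ)
  calc _ ≤ ∑ i : Fin d, ∑ j : Fin d, ‖ζ‖ * ‖M‖ :=
        norm_sum_le_of_le _ fun i _ => norm_sum_le_of_le _ fun j _ => this i j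
    _ = _ := by simp; ring

end apply2

theorem pow_cmp {x T E p q : ℝ} (hx : 0 ≤ x) (hxT : x ≤ T) (hp : 0 ≤ p) (hpq : p ≤ q)
    (hq : q ≤ E + p) : x ^ q ≤ (1 + T) ^ E * x ^ p := by
  have : x ^ q = x ^ (q - p) * x ^ p := by
    rw [← Real.rpow_add_of_nonneg hx (by linarith) hp]; congr 1; ring
  rw [this]
  refine mul_le_mul_of_nonneg_right ?_ (Real.rpow_nonneg hx _)
  calc x ^ (q - p) ≤ (1 + T) ^ (q - p) := Real.rpow_le_rpow hx (by linarith) (by linarith)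
    _ ≤ (1 + T) ^ E := Real.rpow_le_rpow_of_exponent_le (by linarith) (by linarith)

theorem exists_bound {d : ℕ} {r γ : ℝ} (RP : DelayedRoughPath d r γ) (a b : ℝ) :
    ∃ H : ℝ, 0 ≤ H ∧
      (∀ s ∈ Icc a b, ∀ t ∈ Icc a b, ‖RP.X t - RP.X s‖ ≤ H * |t - s| ^ γ) ∧
      (∀ s ∈ Icc a b, ∀ t ∈ Icc a b, ‖RP.X (t - r) - RP.X (s - r)‖ ≤ H * |t - s| ^ γ) ∧
      (∀ s ∈ Icc a b, ∀ t ∈ Icc a b, (d : ℝ) * d * ‖RP.XX s t‖ ≤ H * |t - s| ^ (2 * γ)) ∧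
      (∀ s ∈ Icc a b, ∀ t ∈ Icc a b, (d : ℝ) * d * ‖RP.XXd s t‖ ≤ H * |t - s| ^ (2 * γ)) := by
  obtain ⟨c1, h1⟩ := RP.holX a b
  obtain ⟨c2, h2⟩ := RP.holX (a - r) (b - r)
  obtain ⟨c3, h3⟩ := RP.holXX a b
  obtain ⟨c4, h4⟩ := RP.holXXd a b
  have hd : (0 : ℝ) ≤ (d : ℝ) * d := by positivity
  have n3 : 0 ≤ (d : ℝ) * d * |c3| := by positivity
  have n4 : 0 ≤ (d : ℝ) * d * |c4| := by positivity
  have n1 := abs_nonneg c1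
  have n2 := abs_nonneg c2
  have l1 := le_abs_self c1
  have l2 := le_abs_self c2
  refine ⟨|c1| + |c2| + (d : ℝ) * d * |c3| + (d : ℝ) * d * |c4|, by positivity, ?_, ?_, ?_, ?_⟩
  · intro s hs t ht
    refine (h1 s hs t ht).trans (mul_le_mul_of_nonneg_right (by linarith) (by positivity))
  · intro s hs t ht
    have := h2 (s - r) ⟨by linarith [hs.1], by linarith [hs.2]⟩ (t - r)
      ⟨by linarith [ht.1], by linarith [ht.2]⟩
    rw [show t - r - (s - r) = t - s by ring] at this
    exact this.trans (mul_le_mul_of_nonneg_right (by linarith) (by positivity))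
  · intro s hs t ht
    have := mul_le_mul_of_nonneg_left (h3 s hs t ht) hd
    rw [← mul_assoc] at this
    refine this.trans (mul_le_mul_of_nonneg_right ?_ (by positivity))
    have := mul_le_mul_of_nonneg_left (le_abs_self c3) hd
    linarith
  · intro s hs t ht
    have := mul_le_mul_of_nonneg_left (h4 s hs t ht) hd
    rw [← mul_assoc] at this
    refine this.trans (mul_le_mul_of_nonneg_right ?_ (by positivity))
    have := mul_le_mul_of_nonneg_left (le_abs_self c4) hd
    linarith

theorem sup_bound {V : Type*} [NormedAddCommGroup V] (f : ℝ → V) (a b N κ Q : ℝ) (hN : 0 ≤ N)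
    (ha : ‖f a‖ ≤ N) (h : ∀ s ∈ Icc a b, ∀ t ∈ Icc a b, ‖f t - f s‖ ≤ N * |t - s| ^ κ)
    (hQ1 : 1 ≤ Q) (hQ : ∀ x, 0 ≤ x → x ≤ b - a → x ^ κ ≤ Q) :
    ∀ s ∈ Icc a b, ‖f s‖ ≤ 2 * Q * N := by
  intro s hs
  have h1 := h a ⟨le_rfl, hs.1.trans hs.2⟩ s hs
  rw [abs_of_nonneg (by linarith [hs.1])] at h1
  have h2 := mul_le_mul_of_nonneg_left (hQ (s - a) (by linarith [hs.1]) (by linarith [hs.2])) hN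
  have h3 : ‖f s‖ ≤ ‖f s - f a‖ + ‖f a‖ := by
    simpa using norm_add_le (f s - f a) (f a)
  nlinarith

/-- The germ of the rough integral. -/
def germ {d : ℕ} {r γ : ℝ} {W : Type*} [NormedAddCommGroup W] [NormedSpace ℝ W]
    (RP : DelayedRoughPath d r γ) (m : ℝ → (Fin d → ℝ) →L[ℝ] W)
    (ζ0 ζ1 : ℝ → (Fin d → ℝ) →L[ℝ] ((Fin d → ℝ) →L[ℝ] W)) (s t : ℝ) : W :=
  m s (RP.X t - RP.X s) + apply2 (ζ0 s) (RP.XX s t) + apply2 (ζ1 s) (RP.XXd s t)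

theorem germ_defect {d : ℕ} {r γ : ℝ} {W : Type*} [NormedAddCommGroup W] [NormedSpace ℝ W]
    (RP : DelayedRoughPath d r γ) (m : ℝ → (Fin d → ℝ) →L[ℝ] W)
    (ζ0 ζ1 : ℝ → (Fin d → ℝ) →L[ℝ] ((Fin d → ℝ) →L[ℝ] W)) (s u t : ℝ) :
    germ RP m ζ0 ζ1 s t - germ RP m ζ0 ζ1 s u - germ RP m ζ0 ζ1 u t =
      - ((m u - m s - ζ0 s (RP.X u - RP.X s) - ζ1 s (RP.X (u - r) - RP.X (s - r)))
          (RP.X t - RP.X u)) - apply2 (ζ0 u - ζ0 s) (RP.XX u t)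
        - apply2 (ζ1 u - ζ1 s) (RP.XXd u t) := by
  have h0 : apply2 (ζ0 s) (RP.XX s t) = apply2 (ζ0 s) (RP.XX s u) + apply2 (ζ0 s) (RP.XX u t)
      + ζ0 s (RP.X u - RP.X s) (RP.X t - RP.X u) := by
    rw [RP.chen s u t, apply2_add, apply2_add, ← apply2_tensor]
    rfl
  have h1 : apply2 (ζ1 s) (RP.XXd s t) = apply2 (ζ1 s) (RP.XXd s u) + apply2 (ζ1 s) (RP.XXd u t)
      + ζ1 s (RP.X (u - r) - RP.X (s - r)) (RP.X t - RP.X u) := by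
    rw [RP.chend s u t, apply2_add, apply2_add, ← apply2_tensor]
    rfl
  have hm : m s (RP.X t - RP.X s) = m s (RP.X t - RP.X u) + m s (RP.X u - RP.X s) := by
    rw [← map_add]; congr 1; abel
  simp only [germ]
  rw [h0, h1, hm, apply2_sub_left, apply2_sub_left]
  simp only [sub_apply]
  abel

theorem apply2_bd {d : ℕ} {W : Type*} [NormedAddCommGroup W] [NormedSpace ℝ W]
    (ζ : (Fin d → ℝ) →L[ℝ] ((Fin d → ℝ) →L[ℝ] W)) (M : Fin d → Fin d → ℝ) (A B : ℝ)
    (hA : ‖ζ‖ ≤ A) (hB : (d : ℝ) * d * ‖M‖ ≤ B) : ‖apply2 ζ M‖ ≤ A * B := by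
  refine (norm_apply2_le ζ M).trans ?_
  calc (d : ℝ) * d * (‖ζ‖ * ‖M‖) = ‖ζ‖ * ((d : ℝ) * d * ‖M‖) := by ring
    _ ≤ A * B := mul_le_mul hA hB (by positivity)
      ((ContinuousLinearMap.opNorm_nonneg ζ).trans hA)

theorem clm_bd {V W : Type*} [NormedAddCommGroup V] [NormedSpace ℝ V]
    [NormedAddCommGroup W] [NormedSpace ℝ W] (L : V →L[ℝ] W) (x : V) (A B : ℝ)
    (hA : ‖L‖ ≤ A) (hB : ‖x‖ ≤ B) : ‖L x‖ ≤ A * B :=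
  (L.le_opNorm x).trans (mul_le_mul hA hB (norm_nonneg x)
    ((ContinuousLinearMap.opNorm_nonneg L).trans hA))

theorem key {d : ℕ} {r γ : ℝ} (hγ1 : 1 / 3 < γ) (hγ2 : γ ≤ 1 / 2)
    {W : Type*} [NormedAddCommGroup W] [NormedSpace ℝ W] [FiniteDimensional ℝ W]
    (RP : DelayedRoughPath d r γ) (a b : ℝ) (hab : a ≤ b)
    {α β θ : ℝ} (hα : 0 < α) (hβ : 0 < β) (hθ : 0 < θ)
    (hθγ : 1 < θ + γ) (hβγ : 1 < β + 2 * γ) :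
    ∃ C : ℝ, 0 ≤ C ∧ ∀ (m : ℝ → (Fin d → ℝ) →L[ℝ] W)
        (ζ0 ζ1 : ℝ → (Fin d → ℝ) →L[ℝ] ((Fin d → ℝ) →L[ℝ] W)) (N : ℝ), 0 ≤ N →
      ‖m a‖ ≤ N → ‖ζ0 a‖ ≤ N → ‖ζ1 a‖ ≤ N →
      (∀ s ∈ Icc a b, ∀ t ∈ Icc a b, ‖m t - m s‖ ≤ N * |t - s| ^ α) →
      (∀ s ∈ Icc a b, ∀ t ∈ Icc a b, ‖ζ0 t - ζ0 s‖ ≤ N * |t - s| ^ β) →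
      (∀ s ∈ Icc a b, ∀ t ∈ Icc a b, ‖ζ1 t - ζ1 s‖ ≤ N * |t - s| ^ β) →
      (∀ s ∈ Icc a b, ∀ t ∈ Icc a b,
        ‖m t - m s - ζ0 s (RP.X t - RP.X s) - ζ1 s (RP.X (t - r) - RP.X (s - r))‖
          ≤ N * |t - s| ^ θ) →
      ∃ J : ℝ → W, J a = 0 ∧
        (∀ s t, a ≤ s → s ≤ t → t ≤ b → HasRoughIntegral RP m ζ0 ζ1 s t (J t - J s)) ∧
        (∀ s ∈ Icc a b, ∀ t ∈ Icc a b, ‖J t - J s‖ ≤ C * N * |t - s| ^ γ) ∧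
        (∀ s ∈ Icc a b, ∀ t ∈ Icc a b,
          ‖J t - J s - m s (RP.X t - RP.X s)‖ ≤ C * N * |t - s| ^ (2 * γ)) := by
  have : ProperSpace W := FiniteDimensional.proper ℝ W
  obtain ⟨H, hH, hX, hXr, hXX, hXXd⟩ := exists_bound RP a b
  obtain ⟨p, hp1, hpθ, hpβ⟩ : ∃ p : ℝ, 1 < p ∧ p ≤ θ + γ ∧ p ≤ β + 2 * γ :=
    ⟨min (θ + γ) (β + 2 * γ), lt_min hθγ hβγ, min_le_left _ _, min_le_right _ _⟩
  set E := α + β + θ + 3 * γ with hE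
  set Q := (1 + (b - a)) ^ E with hQ
  have hQ1 : 1 ≤ Q := Real.one_le_rpow (by linarith) (by linarith)
  have hcmp : ∀ x p q : ℝ, 0 ≤ x → x ≤ b - a → 0 ≤ p → p ≤ q → q ≤ E + p →
      x ^ q ≤ Q * x ^ p := fun x p q h1 h2 h3 h4 h5 => pow_cmp h1 h2 h3 h4 h5
  have hhalf : (1 / 2 : ℝ) ^ p < 1 / 2 := by
    have := Real.rpow_lt_rpow_of_exponent_gt (x := (1 / 2 : ℝ)) (by norm_num) (by norm_num) hp1
    rwa [Real.rpow_one] at this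
  obtain ⟨S, hS0, hSp⟩ : ∃ S : ℝ, 0 ≤ S ∧ 2 * (S * (1 / 2 : ℝ) ^ p) + 2 ≤ S := by
    have hpos : 0 < 1 - 2 * (1 / 2 : ℝ) ^ p := by linarith
    refine ⟨2 / (1 - 2 * (1 / 2 : ℝ) ^ p), by positivity, le_of_eq ?_⟩
    field_simp
    ring
  have hQ0 : 0 ≤ Q := by linarith
  set D := 3 * S * H * Q ^ 2 + 4 * Q * H + H * (4 * Q * H + Q) with hD
  have hD0 : 0 ≤ D := by positivity
  refine ⟨D + 2 * Q * H + D * Q, by positivity, ?_⟩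
  intro m ζ0 ζ1 N hN hma h0a h1a hm h0 h1 hrem
  have hQκ : ∀ κ : ℝ, 0 ≤ κ → κ ≤ E → ∀ x, 0 ≤ x → x ≤ b - a → x ^ κ ≤ Q := by
    intro κ hκ hκE x hx hxb
    have := hcmp x 0 κ hx hxb le_rfl hκ (by linarith)
    rwa [Real.rpow_zero, mul_one] at this
  have sm := sup_bound m a b N α Q hN hma hm hQ1 (hQκ α hα.le (by linarith))
  have s0 := sup_bound ζ0 a b N β Q hN h0a h0 hQ1 (hQκ β hβ.le (by linarith))
  have s1 := sup_bound ζ1 a b N β Q hN h1a h1 hQ1 (hQκ β hβ.le (by linarith))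
  have hdef : ∀ s u t, a ≤ s → s ≤ u → u ≤ t → t ≤ b →
      ‖germ RP m ζ0 ζ1 s t - germ RP m ζ0 ζ1 s u - germ RP m ζ0 ζ1 u t‖
        ≤ (3 * N * H * Q) * (t - s) ^ p := by
    intro s u t has hsu hut htb
    have ms : s ∈ Icc a b := ⟨has, by linarith⟩
    have mu : u ∈ Icc a b := ⟨by linarith, by linarith⟩
    have mt : t ∈ Icc a b := ⟨by linarith, htb⟩
    have hx0 : 0 ≤ t - s := by linarith
    have mono1 : ∀ κ : ℝ, 0 ≤ κ → |u - s| ^ κ ≤ (t - s) ^ κ := fun κ hκ =>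
      Real.rpow_le_rpow (abs_nonneg _) (by rw [abs_of_nonneg (by linarith)]; linarith) hκ
    have mono2 : ∀ κ : ℝ, 0 ≤ κ → |t - u| ^ κ ≤ (t - s) ^ κ := fun κ hκ =>
      Real.rpow_le_rpow (abs_nonneg _) (by rw [abs_of_nonneg (by linarith)]; linarith) hκ
    have c1 := hcmp (t - s) p (θ + γ) hx0 (by linarith) (by linarith) hpθ (by linarith)
    have c2 := hcmp (t - s) p (β + 2 * γ) hx0 (by linarith) (by linarith) hpβ (by linarith)
    rw [Real.rpow_add_of_nonneg hx0 (by linarith) (by linarith)] at c1 c2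
    have hNH : 0 ≤ N * H := mul_nonneg hN hH
    have t1 := clm_bd _ _ _ _
      ((hrem s ms u mu).trans (mul_le_mul_of_nonneg_left (mono1 θ hθ.le) hN))
      ((hX u mu t mt).trans (mul_le_mul_of_nonneg_left (mono2 γ (by linarith)) hH))
    have t2 := apply2_bd _ _ _ _
      ((h0 s ms u mu).trans (mul_le_mul_of_nonneg_left (mono1 β hβ.le) hN))
      ((hXX u mu t mt).trans (mul_le_mul_of_nonneg_left (mono2 (2 * γ) (by linarith)) hH))
    have t3 := apply2_bd _ _ _ _
      ((h1 s ms u mu).trans (mul_le_mul_of_nonneg_left (mono1 β hβ.le) hN))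
      ((hXXd u mu t mt).trans (mul_le_mul_of_nonneg_left (mono2 (2 * γ) (by linarith)) hH))
    have c1' := mul_le_mul_of_nonneg_left c1 hNH
    have c2' := mul_le_mul_of_nonneg_left c2 hNH
    rw [germ_defect]
    refine (norm_sub_le _ _).trans ((add_le_add_left (norm_sub_le _ _) _).trans ?_)
    rw [norm_neg]
    linarith
  obtain ⟨J, hJa, hJ⟩ := sewing (germ RP m ζ0 ζ1) a b (3 * N * H * Q) p S hab (by positivity)
    (by linarith) hS0 hSp hdef
  have hmγ : ∀ s ∈ Icc a b, ∀ t ∈ Icc a b,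
      ‖m t - m s‖ ≤ (4 * Q * H + Q) * N * |t - s| ^ γ := by
    intro s hs t ht
    have hxb : |t - s| ≤ b - a := by
      rw [abs_le]; constructor <;> linarith [hs.1, hs.2, ht.1, ht.2]
    have c1 := mul_le_mul_of_nonneg_left
      (hcmp |t - s| γ θ (abs_nonneg _) hxb (by linarith) (by linarith) (by linarith)) hN
    have b0 := clm_bd _ _ _ _ (s0 s hs) (hX s hs t ht)
    have b1 := clm_bd _ _ _ _ (s1 s hs) (hXr s hs t ht)
    have b2 := hrem s hs t ht
    have e : m t - m s = (m t - m s - ζ0 s (RP.X t - RP.X s)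
        - ζ1 s (RP.X (t - r) - RP.X (s - r))) + ζ0 s (RP.X t - RP.X s)
        + ζ1 s (RP.X (t - r) - RP.X (s - r)) := by abel
    rw [e]
    refine (norm_add_le _ _).trans ((add_le_add_left (norm_add_le _ _) _).trans ?_)
    linarith
  have hremle : ∀ s ∈ Icc a b, ∀ t ∈ Icc a b, s ≤ t →
      ‖J t - J s - m s (RP.X t - RP.X s)‖
        ≤ (3 * S * H * Q ^ 2 + 4 * Q * H) * N * |t - s| ^ (2 * γ) := by
    intro s hs t ht hst
    have hx0 : 0 ≤ t - s := by linarith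
    have b0 := apply2_bd _ _ _ _ (s0 s hs) (hXX s hs t ht)
    have b1 := apply2_bd _ _ _ _ (s1 s hs) (hXXd s hs t ht)
    have b2 := hJ s t hs.1 hst ht.2
    have hK : 0 ≤ S * (3 * N * H * Q) := by positivity
    have c1 := mul_le_mul_of_nonneg_left
      (hcmp (t - s) (2 * γ) p hx0 (by linarith [hs.1, ht.2]) (by linarith) (by linarith)
        (by linarith)) hK
    rw [abs_of_nonneg hx0] at b0 b1 ⊢
    have e : J t - J s - m s (RP.X t - RP.X s) = (J t - J s - germ RP m ζ0 ζ1 s t)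
        + apply2 (ζ0 s) (RP.XX s t) + apply2 (ζ1 s) (RP.XXd s t) := by
      simp only [germ]; abel
    rw [e]
    refine (norm_add_le _ _).trans ((add_le_add_left (norm_add_le _ _) _).trans ?_)
    linarith
  have hremall : ∀ s ∈ Icc a b, ∀ t ∈ Icc a b,
      ‖J t - J s - m s (RP.X t - RP.X s)‖ ≤ D * N * |t - s| ^ (2 * γ) := by
    intro s hs t ht
    have hnn : 0 ≤ H * (4 * Q * H + Q) * N * |t - s| ^ (2 * γ) := by positivity
    rcases le_total s t with hst | hst
    · have := hremle s hs t ht hst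
      rw [hD]
      linarith
    · have b1 := hremle t ht s hs hst
      have b2 := clm_bd _ _ _ _ (hmγ t ht s hs) (hX t ht s hs)
      rw [abs_sub_comm s t] at b1 b2
      have e : J t - J s - m s (RP.X t - RP.X s) =
          (m s - m t) (RP.X s - RP.X t) - (J s - J t - m t (RP.X s - RP.X t)) := by
        simp only [sub_apply, map_sub]; abel
      have e2 : |t - s| ^ (2 * γ) = |t - s| ^ γ * |t - s| ^ γ := by
        rw [← Real.rpow_add_of_nonneg (abs_nonneg _) (by linarith) (by linarith)]
        congr 1; ring
      rw [e]
      refine (norm_sub_le _ _).trans ?_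
      rw [hD]
      rw [e2] at b1 ⊢
      linarith
  refine ⟨J, hJa, ?_, ?_, ?_⟩
  · intro s t has hst htb
    exact riemann_conv (germ RP m ζ0 ζ1) J a b (S * (3 * N * H * Q)) p (by positivity) hp1 hJ
      s t has hst htb
  · intro s hs t ht
    have hxb : |t - s| ≤ b - a := by
      rw [abs_le]; constructor <;> linarith [hs.1, hs.2, ht.1, ht.2]
    have c1 := mul_le_mul_of_nonneg_left
      (hcmp |t - s| γ (2 * γ) (abs_nonneg _) hxb (by linarith) (by linarith) (by linarith))
      (mul_nonneg hD0 hN)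
    have b1 := hremall s hs t ht
    have b2 := clm_bd _ _ _ _ (sm s hs) (hX s hs t ht)
    have hnn : 0 ≤ D * N * |t - s| ^ γ := by positivity
    have h3 : ‖J t - J s‖ ≤ ‖J t - J s - m s (RP.X t - RP.X s)‖ + ‖m s (RP.X t - RP.X s)‖ := by
      simpa using norm_add_le (J t - J s - m s (RP.X t - RP.X s)) (m s (RP.X t - RP.X s))
    linarith
  · intro s hs t ht
    have b1 := hremall s hs t ht
    have hnn : 0 ≤ (2 * Q * H + D * Q) * N * |t - s| ^ (2 * γ) := by positivity
    linarith

/-- The infimum in the definition of the seminorms is attained. -/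
theorem sInf_attained (I : Set ℝ) (F : ℝ → ℝ → ℝ) (κ : ℝ)
    (h : ∃ C : ℝ, ∀ s ∈ I, ∀ t ∈ I, F s t ≤ C * |t - s| ^ κ) :
    0 ≤ sInf {C : ℝ | 0 ≤ C ∧ ∀ s ∈ I, ∀ t ∈ I, F s t ≤ C * |t - s| ^ κ} ∧
    ∀ s ∈ I, ∀ t ∈ I, F s t ≤
      sInf {C : ℝ | 0 ≤ C ∧ ∀ s ∈ I, ∀ t ∈ I, F s t ≤ C * |t - s| ^ κ} * |t - s| ^ κ := by
  set A := {C : ℝ | 0 ≤ C ∧ ∀ s ∈ I, ∀ t ∈ I, F s t ≤ C * |t - s| ^ κ} with hA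
  have hne : A.Nonempty := by
    obtain ⟨C, hC⟩ := h
    refine ⟨|C|, abs_nonneg C, fun s hs t ht => (hC s hs t ht).trans ?_⟩
    exact mul_le_mul_of_nonneg_right (le_abs_self C) (by positivity)
  refine ⟨Real.sInf_nonneg fun C hC => hC.1, ?_⟩
  intro s hs t ht
  have hx : 0 ≤ |t - s| ^ κ := by positivity
  rcases hx.eq_or_lt with h0 | hpos
  · obtain ⟨C, hC⟩ := hne
    have := hC.2 s hs t ht
    rw [← h0] at this ⊢
    simpa using this
  · rw [← div_le_iff₀ hpos]
    refine le_csInf hne fun C hC => ?_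
    rw [div_le_iff₀ hpos]
    exact hC.2 s hs t ht

theorem sInf_le_of (I : Set ℝ) (F : ℝ → ℝ → ℝ) (κ C : ℝ) (hC : 0 ≤ C)
    (h : ∀ s ∈ I, ∀ t ∈ I, F s t ≤ C * |t - s| ^ κ) :
    sInf {C : ℝ | 0 ≤ C ∧ ∀ s ∈ I, ∀ t ∈ I, F s t ≤ C * |t - s| ^ κ} ≤ C :=
  csInf_le ⟨0, fun _ hx => hx.1⟩ ⟨hC, h⟩

end SewAux

open SDDE Set in
/-- Sewing for delayed `(α,β,θ)`-controlled paths: the compensated Riemann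
sums converge on every `[s,t] ⊆ [a,b]`; the indefinite integral `z`, with `ζ⁰ = m` and
`ζ¹ = 0`, is a delayed `(γ,α,2γ)`-controlled path; and the linear map `m ↦ z` is
continuous (bounded). -/
theorem delayed_sewing
    {d : ℕ} {r γ : ℝ} (hr : 0 < r) (hγ1 : 1 / 3 < γ) (hγ2 : γ ≤ 1 / 2)
    {W : Type*} [NormedAddCommGroup W] [NormedSpace ℝ W] [FiniteDimensional ℝ W]
    (RP : DelayedRoughPath d r γ) (a b : ℝ) (hab : a ≤ b)
    {α β θ : ℝ} (hα : 0 < α) (hβ : 0 < β) (hθ : 0 < θ)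
    (hθγ : 1 < θ + γ) (hβγ : 1 < β + 2 * γ) :
    (∀ (m : ℝ → (Fin d → ℝ) →L[ℝ] W)
        (ζ0 ζ1 : ℝ → (Fin d → ℝ) →L[ℝ] ((Fin d → ℝ) →L[ℝ] W)),
      IsDelayedControlled r α β θ RP.X a b m ζ0 ζ1 →
        (∀ s t : ℝ, a ≤ s → s ≤ t → t ≤ b →
          ∃ v : W, HasRoughIntegral RP m ζ0 ζ1 s t v) ∧
        ∃ z : ℝ → W, (∀ t ∈ Icc a b, HasRoughIntegral RP m ζ0 ζ1 a t (z t)) ∧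
          IsDelayedControlled r γ α (2 * γ) RP.X a b z m (fun _ => 0)) ∧
    ∃ C : ℝ, 0 ≤ C ∧
      ∀ (m : ℝ → (Fin d → ℝ) →L[ℝ] W)
        (ζ0 ζ1 : ℝ → (Fin d → ℝ) →L[ℝ] ((Fin d → ℝ) →L[ℝ] W)),
        IsDelayedControlled r α β θ RP.X a b m ζ0 ζ1 →
          ∀ z : ℝ → W, (∀ t ∈ Icc a b, HasRoughIntegral RP m ζ0 ζ1 a t (z t)) →
            dcpNorm r γ α (2 * γ) RP.X a b z m (fun _ => 0) ≤
              C * dcpNorm r α β θ RP.X a b m ζ0 ζ1 := by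
  obtain ⟨C, hC, hkey⟩ := SewAux.key hγ1 hγ2 (W := W) RP a b hab hα hβ hθ hθγ hβγ
  have hmain : ∀ (m : ℝ → (Fin d → ℝ) →L[ℝ] W)
      (ζ0 ζ1 : ℝ → (Fin d → ℝ) →L[ℝ] ((Fin d → ℝ) →L[ℝ] W)),
      IsDelayedControlled r α β θ RP.X a b m ζ0 ζ1 →
      0 ≤ dcpNorm r α β θ RP.X a b m ζ0 ζ1 ∧
      ‖m a‖ + holderNorm α (Icc a b) m ≤ dcpNorm r α β θ RP.X a b m ζ0 ζ1 ∧
      ∃ J : ℝ → W, J a = 0 ∧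
        (∀ s t, a ≤ s → s ≤ t → t ≤ b → HasRoughIntegral RP m ζ0 ζ1 s t (J t - J s)) ∧
        (∀ s ∈ Icc a b, ∀ t ∈ Icc a b,
          ‖J t - J s‖ ≤ C * dcpNorm r α β θ RP.X a b m ζ0 ζ1 * |t - s| ^ γ) ∧
        (∀ s ∈ Icc a b, ∀ t ∈ Icc a b,
          ‖J t - J s - m s (RP.X t - RP.X s)‖
            ≤ C * dcpNorm r α β θ RP.X a b m ζ0 ζ1 * |t - s| ^ (2 * γ)) := by
    rintro m ζ0 ζ1 ⟨hm, h0, h1, hrem⟩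
    obtain ⟨nm, am⟩ := SewAux.sInf_attained (Icc a b) (fun s t => ‖m t - m s‖) α hm
    obtain ⟨n0, a0⟩ := SewAux.sInf_attained (Icc a b) (fun s t => ‖ζ0 t - ζ0 s‖) β h0
    obtain ⟨n1, a1⟩ := SewAux.sInf_attained (Icc a b) (fun s t => ‖ζ1 t - ζ1 s‖) β h1
    obtain ⟨nr, ar⟩ := SewAux.sInf_attained (Icc a b) (fun s t =>
      ‖m t - m s - ζ0 s (RP.X t - RP.X s) - ζ1 s (RP.X (t - r) - RP.X (s - r))‖) θ hrem
    set cm := sInf {C : ℝ | 0 ≤ C ∧ ∀ s ∈ Icc a b, ∀ t ∈ Icc a b,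
      (fun s t => ‖m t - m s‖) s t ≤ C * |t - s| ^ α} with hcm
    set c0 := sInf {C : ℝ | 0 ≤ C ∧ ∀ s ∈ Icc a b, ∀ t ∈ Icc a b,
      (fun s t => ‖ζ0 t - ζ0 s‖) s t ≤ C * |t - s| ^ β} with hc0
    set c1 := sInf {C : ℝ | 0 ≤ C ∧ ∀ s ∈ Icc a b, ∀ t ∈ Icc a b,
      (fun s t => ‖ζ1 t - ζ1 s‖) s t ≤ C * |t - s| ^ β} with hc1
    set cr := sInf {C : ℝ | 0 ≤ C ∧ ∀ s ∈ Icc a b, ∀ t ∈ Icc a b,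
      (fun s t => ‖m t - m s - ζ0 s (RP.X t - RP.X s) - ζ1 s (RP.X (t - r) - RP.X (s - r))‖) s t
        ≤ C * |t - s| ^ θ} with hcr
    have hN : dcpNorm r α β θ RP.X a b m ζ0 ζ1 =
        ‖m a‖ + ‖ζ0 a‖ + ‖ζ1 a‖ + cm + c0 + c1 + cr := rfl
    have hh : holderNorm α (Icc a b) m = cm := rfl
    have pm : 0 ≤ ‖m a‖ := ContinuousLinearMap.opNorm_nonneg _
    have p0 : 0 ≤ ‖ζ0 a‖ := ContinuousLinearMap.opNorm_nonneg _
    have p1 : 0 ≤ ‖ζ1 a‖ := ContinuousLinearMap.opNorm_nonneg _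
    rw [hh]
    set N := dcpNorm r α β θ RP.X a b m ζ0 ζ1
    refine ⟨by linarith, by linarith, ?_⟩
    refine hkey m ζ0 ζ1 N (by linarith) (by linarith) (by linarith) (by linarith) ?_ ?_ ?_ ?_
    · exact fun s hs t ht => (am s hs t ht).trans
        (mul_le_mul_of_nonneg_right (by linarith) (by positivity))
    · exact fun s hs t ht => (a0 s hs t ht).trans
        (mul_le_mul_of_nonneg_right (by linarith) (by positivity))
    · exact fun s hs t ht => (a1 s hs t ht).trans
        (mul_le_mul_of_nonneg_right (by linarith) (by positivity))
    · exact fun s hs t ht => (ar s hs t ht).trans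
        (mul_le_mul_of_nonneg_right (by linarith) (by positivity))
  refine ⟨?_, 1 + 2 * C, by positivity, ?_⟩
  · intro m ζ0 ζ1 h
    obtain ⟨-, -, J, hJa, hJ, hJγ, hJr⟩ := hmain m ζ0 ζ1 h
    refine ⟨fun s t has hst htb => ⟨_, hJ s t has hst htb⟩, J, ?_, ⟨_, hJγ⟩, h.1, ⟨0, ?_⟩,
      ⟨C * dcpNorm r α β θ RP.X a b m ζ0 ζ1, ?_⟩⟩
    · intro t ht
      have := hJ a t le_rfl ht.1 ht.2
      rwa [hJa, sub_zero] at this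
    · intro s _ t _
      simp
    · intro s hs t ht
      have := hJr s hs t ht
      simpa using this
  · intro m ζ0 ζ1 h z hz
    obtain ⟨hN, hle, J, hJa, hJ, hJγ, hJr⟩ := hmain m ζ0 ζ1 h
    set N := dcpNorm r α β θ RP.X a b m ζ0 ζ1
    have hzJ : ∀ t ∈ Icc a b, z t = J t := by
      intro t ht
      have := hJ a t le_rfl ht.1 ht.2
      rw [hJa, sub_zero] at this
      exact SewAux.integral_unique RP m ζ0 ζ1 a t ht.1 _ _ (hz t ht) this
    have hCN : 0 ≤ C * N := mul_nonneg hC hN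
    have hza : ‖z a‖ = 0 := by rw [hzJ a ⟨le_rfl, hab⟩, hJa, norm_zero]
    have e1 : holderNorm γ (Icc a b) z ≤ C * N := by
      refine SewAux.sInf_le_of (Icc a b) (fun s t => ‖z t - z s‖) γ _ hCN ?_
      intro s hs t ht
      try dsimp only
      rw [hzJ s hs, hzJ t ht]
      exact hJγ s hs t ht
    have e2 : holderNorm α (Icc a b) (fun _ => (0 : (Fin d → ℝ) →L[ℝ] W)) ≤ 0 := by
      refine SewAux.sInf_le_of (Icc a b)
        (fun _ _ => ‖(0 : (Fin d → ℝ) →L[ℝ] W) - 0‖) α _ le_rfl ?_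
      intro s _ t _
      simp
    have e3 : sInf {C : ℝ | 0 ≤ C ∧ ∀ s ∈ Icc a b, ∀ t ∈ Icc a b,
        ‖z t - z s - m s (RP.X t - RP.X s)
          - (fun _ => (0 : (Fin d → ℝ) →L[ℝ] W)) s (RP.X (t - r) - RP.X (s - r))‖
            ≤ C * |t - s| ^ (2 * γ)} ≤ C * N := by
      refine SewAux.sInf_le_of (Icc a b) (fun s t => ‖z t - z s - m s (RP.X t - RP.X s)
          - (fun _ => (0 : (Fin d → ℝ) →L[ℝ] W)) s (RP.X (t - r) - RP.X (s - r))‖) (2 * γ) _ hCN ?_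
      intro s hs t ht
      try dsimp only
      rw [hzJ s hs, hzJ t ht]
      simpa using hJr s hs t ht
    have e4 : ‖(0 : (Fin d → ℝ) →L[ℝ] W)‖ = 0 := norm_zero
    unfold dcpNorm
    have e5 : (1 + 2 * C) * N = N + C * N + C * N := by ring
    rw [e5]
    linarith
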